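/- arXiv:math/0409560 — 4 statements merged into one kernel-verified Lean document; each statement's English description precedes it below -/
import Mathlib

section
/- Let M ≥ 1 and let f₀, f₁ : ℝ → ℝ be differentiable with 1/M ≤ f₀'(x) ≤ M, 1/M ≤ f₁'(x) ≤ M, and |f₀(x) − f₁(x)| ≤ M − 1 for all x ∈ ℝ. Then for every (x,y) ∈ ℝ × [0,1], the total derivative DF(x,y) of the interpolation map F(x,y) = ((1−y)·f₀(x) + y·f₁(x), y) satisfies ‖DF(x,y)‖² / det DF(x,y) ≤ M·(2M−1)², where ‖·‖ denotes the operator norm with respect to the Euclidean norm on ℝ². -/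
/-- The upper triangular map `(u, v) ↦ (a u + b v, v)` of the Euclidean plane. -/
noncomputable def planeShear (a b : ℝ) :
    EuclideanSpace ℝ (Fin 2) →L[ℝ] EuclideanSpace ℝ (Fin 2) :=
  LinearMap.toContinuousLinearMap (Matrix.toLpLin 2 2 !![a, b; 0, 1])

theorem planeShear_apply_zero (a b : ℝ) (v : EuclideanSpace ℝ (Fin 2)) :
    planeShear a b v 0 = a * v 0 + b * v 1 := by
  simp [planeShear, Matrix.toLpLin_apply, dotProduct, Fin.sum_univ_two]

theorem planeShear_apply_one (a b : ℝ) (v : EuclideanSpace ℝ (Fin 2)) :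
    planeShear a b v 1 = v 1 := by
  simp [planeShear, Matrix.toLpLin_apply, dotProduct, Fin.sum_univ_two]

theorem det_planeShear (a b : ℝ) : (planeShear a b).det = a := by
  rw [planeShear, LinearMap.det_toContinuousLinearMap, LinearMap.det_toLpLin,
    Matrix.det_fin_two_of]
  ring

theorem norm_planeShear_le {M a b : ℝ} (hM : 1 ≤ M) (ha : |a| ≤ M) :
    ‖planeShear a b‖ ≤ M + |b| := by
  refine ContinuousLinearMap.opNorm_le_bound _ (by positivity) fun v => ?_
  refine le_of_sq_le_sq ?_ (by positivity)
  rw [mul_pow, EuclideanSpace.real_norm_sq_eq, EuclideanSpace.real_norm_sq_eq,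
    Fin.sum_univ_two, Fin.sum_univ_two, planeShear_apply_zero, planeShear_apply_one]
  have ha2 : a ^ 2 ≤ M ^ 2 := sq_le_sq.2 (ha.trans (le_abs_self M))
  have hcross : 2 * (a * v 0) * (b * v 1) ≤ M * |b| * (v 0 ^ 2 + v 1 ^ 2) := by
    calc 2 * (a * v 0) * (b * v 1) ≤ |2 * (a * v 0) * (b * v 1)| := le_abs_self _
      _ = |a| * |b| * (2 * |v 0| * |v 1|) := by
        simp only [abs_mul, abs_two]; ring
      _ ≤ M * |b| * (v 0 ^ 2 + v 1 ^ 2) := by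
        gcongr
        simpa only [sq_abs] using two_mul_le_add_sq |v 0| |v 1|
  have hu : a ^ 2 * v 0 ^ 2 ≤ M ^ 2 * v 0 ^ 2 := by gcongr
  have hv : v 1 ^ 2 ≤ M ^ 2 * v 1 ^ 2 :=
    le_mul_of_one_le_left (sq_nonneg _) (one_le_pow₀ hM)
  have hbu : 0 ≤ b ^ 2 * v 0 ^ 2 := by positivity
  have hs : 0 ≤ M * |b| * (v 0 ^ 2 + v 1 ^ 2) := by positivity
  linear_combination hcross + hu + hv + hbu + hs - (v 0 ^ 2 + v 1 ^ 2) * sq_abs b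

theorem hasFDerivAt_interpolation {f₀ f₁ : ℝ → ℝ} {a₀ a₁ : ℝ}
    {F : EuclideanSpace ℝ (Fin 2) → EuclideanSpace ℝ (Fin 2)}
    (hF : ∀ p : EuclideanSpace ℝ (Fin 2),
      F p = (WithLp.equiv 2 (Fin 2 → ℝ)).symm
        ![(1 - p 1) * f₀ (p 0) + p 1 * f₁ (p 0), p 1])
    (p : EuclideanSpace ℝ (Fin 2))
    (h₀ : HasDerivAt f₀ a₀ (p 0)) (h₁ : HasDerivAt f₁ a₁ (p 0)) :
    HasFDerivAt F
      (planeShear ((1 - p 1) * a₀ + p 1 * a₁) (f₁ (p 0) - f₀ (p 0))) p := by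
  have hc (i : Fin 2) : HasFDerivAt (fun q : EuclideanSpace ℝ (Fin 2) => q i)
      (EuclideanSpace.proj i : EuclideanSpace ℝ (Fin 2) →L[ℝ] ℝ) p :=
    (EuclideanSpace.proj i : EuclideanSpace ℝ (Fin 2) →L[ℝ] ℝ).hasFDerivAt
  rw [funext hF, ← hasFDerivWithinAt_univ, hasFDerivWithinAt_euclidean]
  intro i
  rw [hasFDerivWithinAt_univ]
  fin_cases i
  · refine ((((hc 1).const_sub 1).mul (h₀.comp_hasFDerivAt p (hc 0))).add
      ((hc 1).mul (h₁.comp_hasFDerivAt p (hc 0)))).congr_fderiv ?_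
    ext v
    simp [planeShear_apply_zero]
    ring
  · refine (hc 1).congr_fderiv ?_
    ext v
    simp [planeShear_apply_one]

/-- Under the hypotheses `1/M ≤ f₀', f₁' ≤ M` and `|f₀ − f₁| ≤ M − 1`,
the total derivative of the interpolation map `F(x,y) = ((1−y)·f₀(x) + y·f₁(x), y)`
(viewed as a map of Euclidean `ℝ²`) has dilatation `‖DF‖²/det DF ≤ M·(2M−1)²` at every
point of the strip `ℝ × [0,1]`, the operator norm being taken w.r.t. the Euclidean norm. -/
theorem interpolation_dilatation_bound
    (M : ℝ) (hM : 1 ≤ M) (f₀ f₁ : ℝ → ℝ)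
    (h₀ : Differentiable ℝ f₀) (h₁ : Differentiable ℝ f₁)
    (h₀d : ∀ x : ℝ, deriv f₀ x ∈ Set.Icc (1/M) M)
    (h₁d : ∀ x : ℝ, deriv f₁ x ∈ Set.Icc (1/M) M)
    (hdist : ∀ x : ℝ, |f₀ x - f₁ x| ≤ M - 1)
    (F : EuclideanSpace ℝ (Fin 2) → EuclideanSpace ℝ (Fin 2))
    (hF : ∀ p : EuclideanSpace ℝ (Fin 2),
      F p = (WithLp.equiv 2 (Fin 2 → ℝ)).symm
        ![(1 - p 1) * f₀ (p 0) + p 1 * f₁ (p 0), p 1]) :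
    ∀ x y : ℝ, y ∈ Set.Icc (0:ℝ) 1 →
      ‖fderiv ℝ F ((WithLp.equiv 2 (Fin 2 → ℝ)).symm ![x, y])‖^2 /
        (fderiv ℝ F ((WithLp.equiv 2 (Fin 2 → ℝ)).symm ![x, y])).det
        ≤ M * (2*M - 1)^2 := by
  rintro x y ⟨hy₀, hy₁⟩
  have hD := hasFDerivAt_interpolation hF ((WithLp.equiv 2 (Fin 2 → ℝ)).symm ![x, y])
    (h₀ _).hasDerivAt (h₁ _).hasDerivAt
  rw [hD.fderiv, det_planeShear]
  simp only [WithLp.equiv_symm_apply, Matrix.cons_val_zero, Matrix.cons_val_one]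
  have hMpos : 0 < M := by linarith
  set a := (1 - y) * deriv f₀ x + y * deriv f₁ x
  have ha : a ∈ Set.Icc (1 / M) M :=
    convex_Icc _ _ (h₀d x) (h₁d x) (sub_nonneg.2 hy₁) hy₀ (by ring)
  have hapos : 0 < a := (one_div_pos.2 hMpos).trans_le ha.1
  have hb : |f₁ x - f₀ x| ≤ M - 1 := abs_sub_comm (f₁ x) (f₀ x) ▸ hdist x
  have hn : ‖planeShear a (f₁ x - f₀ x)‖ ≤ 2 * M - 1 :=
    (norm_planeShear_le hM ((abs_of_pos hapos).trans_le ha.2)).trans (by linarith)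
  have hMa : 1 ≤ M * a := (div_le_iff₀' hMpos).1 ha.1
  rw [div_le_iff₀ hapos]
  calc ‖planeShear a (f₁ x - f₀ x)‖ ^ 2 ≤ (2 * M - 1) ^ 2 := by gcongr
    _ ≤ M * a * (2 * M - 1) ^ 2 := le_mul_of_one_le_left (sq_nonneg _) hMa
    _ = M * (2 * M - 1) ^ 2 * a := by ring
end

section
/- The function φ : ℝ → ℝ defined by φ(x) = x + arctan(8x/(16 + x²)) satisfies 1/2 ≤ φ'(x) ≤ 3/2 for every x ∈ ℝ; in particular φ is a strictly increasing bijection of ℝ onto ℝ. -/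
theorem hasDerivAt_add_arctan_div (x : ℝ) :
    HasDerivAt (fun x : ℝ => x + Real.arctan (8*x/(16 + x^2)))
      (1 + 8 * (16 - x^2) / ((16 + x^2)^2 + 64 * x^2)) x := by
  have h0 : (16 + x^2 : ℝ) ≠ 0 := by positivity
  have h1 : ((16 + x^2)^2 + 64 * x^2 : ℝ) ≠ 0 := by positivity
  have h2 : (1 + (8*x/(16 + x^2))^2 : ℝ) ≠ 0 := by positivity
  have hnum : HasDerivAt (fun x : ℝ => 8 * x) 8 x := by
    simpa using (hasDerivAt_id x).const_mul 8
  have hden : HasDerivAt (fun x : ℝ => 16 + x^2) (2 * x) x := by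
    simpa using (hasDerivAt_pow 2 x).const_add 16
  refine ((hasDerivAt_id x).add (hnum.div hden h0).arctan).congr_deriv ?_
  have h3 : (1 + (8*x/(16 + x^2))^2 : ℝ) = ((16 + x^2)^2 + 64 * x^2) / (16 + x^2)^2 := by
    field_simp
    ring
  simp only [Pi.div_apply, h3]
  field_simp
  ring

/-- The function `φ(x) = x + arctan(8x/(16 + x²))` satisfies
`1/2 ≤ φ'(x) ≤ 3/2` for every `x`; in particular `φ` is a strictly increasing
bijection of `ℝ` onto `ℝ`. -/
theorem boundary_lift_deriv_bounds
    (φ : ℝ → ℝ) (hφ : ∀ x : ℝ, φ x = x + Real.arctan (8*x/(16 + x^2))) :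
    (∀ x : ℝ, deriv φ x ∈ Set.Icc (1/2 : ℝ) (3/2)) ∧
    StrictMono φ ∧ Function.Bijective φ := by
  obtain rfl : φ = fun x => x + Real.arctan (8*x/(16 + x^2)) := funext hφ
  have hbound (x : ℝ) : deriv (fun x : ℝ => x + Real.arctan (8*x/(16 + x^2))) x ∈
      Set.Icc (1/2 : ℝ) (3/2) := by
    rw [(hasDerivAt_add_arctan_div x).deriv]
    have hpos : (0 : ℝ) < (16 + x^2)^2 + 64 * x^2 := by positivity
    have hlower : -(1/2 : ℝ) ≤ 8 * (16 - x^2) / ((16 + x^2)^2 + 64 * x^2) := by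
      rw [le_div_iff₀ hpos]
      nlinarith [sq_nonneg x, sq_nonneg (x^2)]
    have hupper : 8 * (16 - x^2) / ((16 + x^2)^2 + 64 * x^2) ≤ (1/2 : ℝ) := by
      rw [div_le_iff₀ hpos]
      nlinarith [sq_nonneg x, sq_nonneg (x^2)]
    constructor <;> linarith
  have hmono := strictMono_of_deriv_pos fun x => lt_of_lt_of_le (by norm_num) (hbound x).1
  have hcont : Continuous fun x : ℝ => x + Real.arctan (8*x/(16 + x^2)) :=
    continuous_iff_continuousAt.2 fun x => (hasDerivAt_add_arctan_div x).continuousAt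
  refine ⟨hbound, hmono, hmono.injective, hcont.surjective ?_ ?_⟩
  · exact Filter.tendsto_atTop_add_right_of_le _ (-(Real.pi / 2)) Filter.tendsto_id
      fun x => (Real.neg_pi_div_two_lt_arctan _).le
  · exact Filter.tendsto_atBot_add_right_of_ge _ (Real.pi / 2) Filter.tendsto_id
      fun x => (Real.arctan_lt_pi_div_two _).le
end

section
/- Let p : ℝ → ℝ be continuously differentiable and periodic with some period T > 0, and let c > −1 satisfy p'(x) ≥ c for all x ∈ ℝ. Define f(t) = log(e^t + p(e^t)) wherever e^t + p(e^t) > 0. Then there exists t₀ ∈ ℝ such that for all t ≥ t₀ one has e^t + p(e^t) > 0, f is differentiable at t, and f'(t) ≥ (c + 1)/2. -/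
/-- If `p : ℝ → ℝ` is `C¹` and periodic with period `T > 0`, and
`p' ≥ c > −1` everywhere, then the gluing map `f(t) = log(e^t + p(e^t))` satisfies, for all
sufficiently large `t`: `e^t + p(e^t) > 0`, `f` is differentiable at `t`, and
`f'(t) ≥ (c + 1)/2`. -/
theorem gluing_map_f_derivative_bound
    (p : ℝ → ℝ) (T : ℝ) (hT : 0 < T) (hp : ContDiff ℝ 1 p) (hper : Function.Periodic p T)
    (c : ℝ) (hc : -1 < c) (hp' : ∀ x : ℝ, c ≤ deriv p x)
    (f : ℝ → ℝ) (hf : ∀ t : ℝ, f t = Real.log (Real.exp t + p (Real.exp t))) :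
    ∃ t₀ : ℝ, ∀ t : ℝ, t₀ ≤ t →
      0 < Real.exp t + p (Real.exp t) ∧
      DifferentiableAt ℝ f t ∧
      (c + 1)/2 ≤ deriv f t := by
  obtain ⟨M, hM⟩ := (hper.isBounded_of_continuous hT.ne' hp.continuous).exists_norm_le
  have hbound : ∀ x, |p x| ≤ M := fun x => hM _ ⟨x, rfl⟩
  have hM0 : 0 ≤ M := (abs_nonneg _).trans (hbound 0)
  refine ⟨Real.log (M + 1), fun t ht => ?_⟩
  have hx : M + 1 ≤ Real.exp t := (Real.log_le_iff_le_exp (by linarith)).1 ht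
  obtain ⟨hlo, hhi⟩ := abs_le.1 (hbound (Real.exp t))
  have hpos : 0 < Real.exp t + p (Real.exp t) := by linarith
  have hpd : HasDerivAt p (deriv p (Real.exp t)) (Real.exp t) :=
    (hp.differentiable one_ne_zero _).hasDerivAt
  have hexp := Real.hasDerivAt_exp t
  have hfd := (hexp.add (hpd.comp t hexp)).log hpos.ne'
  have hfd' : HasDerivAt f
      ((Real.exp t + deriv p (Real.exp t) * Real.exp t) / (Real.exp t + p (Real.exp t))) t :=
    hfd.congr_of_eventuallyEq (.of_forall hf)
  refine ⟨hpos, hfd'.differentiableAt, ?_⟩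
  rw [hfd'.deriv, le_div_iff₀ hpos]
  calc (c + 1) / 2 * (Real.exp t + p (Real.exp t))
      ≤ (c + 1) / 2 * (2 * Real.exp t) :=
        mul_le_mul_of_nonneg_left (by linarith) (by linarith)
    _ = Real.exp t + c * Real.exp t := by ring
    _ ≤ Real.exp t + deriv p (Real.exp t) * Real.exp t := by
        gcongr
        exact hp' _
end

section
/- Let q : ℝ → ℝ be continuously differentiable and periodic with some period T > 0, and let a > 0. Define g(t) = log(arsinh(a·e^t + q(e^t))) wherever a·e^t + q(e^t) > 0. Then there exist C > 0 and t₀ > 0 such that for all t ≥ t₀ one has a·e^t + q(e^t) > 0, arsinh(a·e^t + q(e^t)) > 1, g is differentiable at t, and g'(t) ≤ C/t. -/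
/-- A continuous periodic real function is bounded in absolute value. -/
theorem Function.Periodic.exists_pos_abs_le_of_continuous {f : ℝ → ℝ} {T : ℝ}
    (hper : Function.Periodic f T) (hT : T ≠ 0) (hf : Continuous f) :
    ∃ M : ℝ, 0 < M ∧ ∀ x, |f x| ≤ M := by
  obtain ⟨M, hM, h⟩ := (hper.isBounded_of_continuous hT hf).exists_pos_norm_le
  exact ⟨M, hM, fun x ↦ h _ ⟨x, rfl⟩⟩

theorem Function.Periodic.deriv {f : ℝ → ℝ} {T : ℝ} (hper : Function.Periodic f T) :
    Function.Periodic (deriv f) T := fun x ↦ by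
  rw [← deriv_comp_add_const, hper.funext]

theorem Real.sinh_le_exp (x : ℝ) : Real.sinh x ≤ Real.exp x := by
  rw [Real.sinh_eq]
  linarith [Real.exp_pos x, Real.exp_pos (-x)]

/-- If `q : ℝ → ℝ` is `C¹` and periodic with period `T > 0`, and `a > 0`,
then the gluing map `g(t) = log(arsinh(a·e^t + q(e^t)))` satisfies, for some `C > 0` and all
sufficiently large `t > 0`: `a·e^t + q(e^t) > 0`, `arsinh(a·e^t + q(e^t)) > 1`, `g` is
differentiable at `t`, and `g'(t) ≤ C/t`. -/
theorem gluing_map_g_derivative_bound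
    (q : ℝ → ℝ) (T : ℝ) (hT : 0 < T) (hq : ContDiff ℝ 1 q) (hper : Function.Periodic q T)
    (a : ℝ) (ha : 0 < a)
    (g : ℝ → ℝ)
    (hg : ∀ t : ℝ, g t = Real.log (Real.arsinh (a * Real.exp t + q (Real.exp t)))) :
    ∃ C : ℝ, 0 < C ∧ ∃ t₀ : ℝ, 0 < t₀ ∧ ∀ t : ℝ, t₀ ≤ t →
      0 < a * Real.exp t + q (Real.exp t) ∧
      1 < Real.arsinh (a * Real.exp t + q (Real.exp t)) ∧
      DifferentiableAt ℝ g t ∧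
      deriv g t ≤ C / t := by
  obtain ⟨M, hM, hqM⟩ := hper.exists_pos_abs_le_of_continuous hT.ne' hq.continuous
  obtain ⟨N, hN, hqN⟩ :=
    hper.deriv.exists_pos_abs_le_of_continuous hT.ne' (hq.continuous_deriv le_rfl)
  refine ⟨4 * (a + N) / a, by positivity, 3 + 4 / a + 2 * M / a, by positivity, fun t ht ↦ ?_⟩
  have h4 : 0 < 4 / a := by positivity
  have h2M : 0 < 2 * M / a := by positivity
  have ht0 : 0 < t := by linarith
  have hxM : M ≤ a / 2 * Real.exp t := by
    have h : 2 * M / a ≤ Real.exp t := by linarith [Real.add_one_le_exp t]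
    rw [div_le_iff₀ ha] at h
    linarith
  have hlower : a / 2 * Real.exp t ≤ a * Real.exp t + q (Real.exp t) := by
    linarith [(abs_le.mp (hqM (Real.exp t))).1]
  have hhalf : Real.exp (t / 2) ≤ a / 2 * Real.exp t := by
    have h : 4 / a ≤ 2 * Real.exp (t / 2) := by linarith [Real.add_one_le_exp (t / 2)]
    rw [div_le_iff₀ ha] at h
    have hsq : Real.exp t = Real.exp (t / 2) * Real.exp (t / 2) := by
      rw [← Real.exp_add, add_halves]
    rw [hsq]
    nlinarith [Real.exp_pos (t / 2)]
  have harsinh : t / 2 ≤ Real.arsinh (a * Real.exp t + q (Real.exp t)) := by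
    rw [← Real.arsinh_sinh (t / 2), Real.arsinh_le_arsinh]
    exact (Real.sinh_le_exp _).trans (hhalf.trans hlower)
  have hsqrt : a / 2 * Real.exp t ≤ √(1 + (a * Real.exp t + q (Real.exp t)) ^ 2) :=
    hlower.trans (Real.le_sqrt_of_sq_le (by linarith))
  have hinner : HasDerivAt (fun s ↦ a * Real.exp s + q (Real.exp s))
      (a * Real.exp t + deriv q (Real.exp t) * Real.exp t) t :=
    ((Real.hasDerivAt_exp t).const_mul a).add
      (((hq.differentiable one_ne_zero) _).hasDerivAt.comp t (Real.hasDerivAt_exp t))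
  have hderiv := hinner.arsinh.log (ne_of_gt (by linarith))
  rw [← funext hg] at hderiv
  have hexp := Real.exp_pos t
  refine ⟨lt_of_lt_of_le (by positivity) hlower, by linarith, hderiv.differentiableAt, ?_⟩
  rw [hderiv.deriv, smul_eq_mul, inv_mul_eq_div, div_div]
  calc (a * Real.exp t + deriv q (Real.exp t) * Real.exp t) /
        (√(1 + (a * Real.exp t + q (Real.exp t)) ^ 2) *
          Real.arsinh (a * Real.exp t + q (Real.exp t)))
      ≤ ((a + N) * Real.exp t) / (a / 2 * Real.exp t * (t / 2)) := by
        gcongr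
        rw [add_mul]
        gcongr
        exact (abs_le.mp (hqN _)).2
    _ = 4 * (a + N) / a / t := by
        field_simp
        ring
end
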